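/- arXiv:1005.4218 — 3 statements merged into one kernel-verified Lean document; each statement's English description precedes it below -/
import Mathlib

section
/- Let g : R -> R be the entire function g(x) = sum_{k>=0} c_k x^k, where c_k = a_k a_{k+1} - a_{k-6} a_{k+7}, a_j = 1/j! for j >= 0, and a_j = 0 for j < 0. Then at x_0 = -56 the Laguerre expression is negative: (g'(x_0))^2 - g(x_0) g''(x_0) < 0. -/
open Finset

/-- The coefficients of the termwise derivative of the power series with coefficients `a`. -/
def derivCoeff (a : ℕ → ℝ) (k : ℕ) : ℝ := (k + 1) * a (k + 1)

theorem abs_derivCoeff_le {a : ℕ → ℝ} (ha : ∀ k, |a k| ≤ 1 / (k.factorial : ℝ) ^ 2) (k : ℕ) :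
    |derivCoeff a k| ≤ 1 / (k.factorial : ℝ) ^ 2 := by
  have hk : (0 : ℝ) < k.factorial := by positivity
  calc |derivCoeff a k| = (k + 1) * |a (k + 1)| := by
        rw [derivCoeff, abs_mul, abs_of_nonneg (by positivity)]
    _ ≤ (k + 1) * (1 / ((k + 1).factorial : ℝ) ^ 2) := by gcongr; exact ha _
    _ = 1 / (k.factorial : ℝ) ^ 2 / (k + 1) := by
        rw [Nat.factorial_succ]; push_cast; field_simp
    _ ≤ 1 / (k.factorial : ℝ) ^ 2 := div_le_self (by positivity) (by simp)

theorem one_div_factorial_sq_le (k : ℕ) :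
    1 / (k.factorial : ℝ) ^ 2 ≤ 1 / (k.factorial : ℝ) := by
  have hk : (1 : ℝ) ≤ k.factorial := by exact_mod_cast k.factorial_pos
  gcongr
  exact le_self_pow₀ hk two_ne_zero

theorem summable_mul_pow_of_abs_le {a : ℕ → ℝ} (ha : ∀ k, |a k| ≤ 1 / (k.factorial : ℝ) ^ 2)
    (x : ℝ) : Summable fun k => a k * x ^ k := by
  refine (Real.summable_pow_div_factorial |x|).of_norm_bounded fun k => ?_
  rw [Real.norm_eq_abs, abs_mul, abs_pow, div_eq_inv_mul, ← one_div]
  gcongr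
  exact (ha k).trans (one_div_factorial_sq_le k)

theorem hasDerivAt_tsum_mul_pow {a : ℕ → ℝ} (ha : ∀ k, |a k| ≤ 1 / (k.factorial : ℝ) ^ 2)
    (x : ℝ) :
    HasDerivAt (fun y => ∑' k, a k * y ^ k) (∑' k, derivCoeff a k * x ^ k) x := by
  set R : ℝ := |x| + 1 with hR
  have hu : Summable fun k : ℕ => 1 / (k.factorial : ℝ) * (k * R ^ (k - 1)) := by
    refine (summable_nat_add_iff 1).1 ((Real.summable_pow_div_factorial R).congr fun k => ?_)
    rw [Nat.factorial_succ]
    push_cast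
    field_simp
  have hx : x ∈ Metric.ball (0 : ℝ) R := by simp [hR]
  have hbound : ∀ (k : ℕ) (y : ℝ), y ∈ Metric.ball (0 : ℝ) R →
      ‖a k * (k * y ^ (k - 1))‖ ≤ 1 / (k.factorial : ℝ) * (k * R ^ (k - 1)) := by
    intro k y hy
    have hy' : |y| ≤ R := by simpa using (mem_ball_zero_iff.1 hy).le
    rw [Real.norm_eq_abs, abs_mul, abs_mul, abs_pow, Nat.abs_cast]
    gcongr
    exact (ha k).trans (one_div_factorial_sq_le k)
  have h := hasDerivAt_tsum_of_isPreconnected hu Metric.isOpen_ball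
    (convex_ball (0 : ℝ) R).isPreconnected
    (fun k y _ => (hasDerivAt_pow k y).const_mul (a k)) hbound hx
    (summable_mul_pow_of_abs_le ha x) hx
  refine h.congr_deriv ?_
  rw [(hu.of_norm_bounded fun k => hbound k x hx).tsum_eq_zero_add]
  simp only [Nat.cast_zero, zero_mul, mul_zero, zero_add, Nat.add_sub_cancel, derivCoeff]
  exact tsum_congr fun k => by push_cast; ring

theorem pow_div_factorial_sq_le {r : ℝ} (hr : 0 ≤ r) {N : ℕ} (hN : 2 * r ≤ ((N : ℝ) + 1) ^ 2)
    (k : ℕ) :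
    r ^ (k + N) / ((k + N).factorial : ℝ) ^ 2 ≤
      r ^ N / (N.factorial : ℝ) ^ 2 * (1 / 2) ^ k := by
  induction k with
  | zero => simp
  | succ k ih =>
    have hq : r / ((k : ℝ) + N + 1) ^ 2 ≤ 1 / 2 := by
      rw [div_le_iff₀ (by positivity)]
      nlinarith [(Nat.cast_nonneg k : (0 : ℝ) ≤ k), (Nat.cast_nonneg N : (0 : ℝ) ≤ N),
        mul_nonneg (Nat.cast_nonneg k : (0 : ℝ) ≤ k) (Nat.cast_nonneg N : (0 : ℝ) ≤ N)]
    calc r ^ (k + 1 + N) / ((k + 1 + N).factorial : ℝ) ^ 2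
        = r ^ (k + N) / ((k + N).factorial : ℝ) ^ 2 * (r / ((k : ℝ) + N + 1) ^ 2) := by
          rw [show k + 1 + N = k + N + 1 by ring, Nat.factorial_succ]
          push_cast
          field_simp
          ring
      _ ≤ r ^ N / (N.factorial : ℝ) ^ 2 * (1 / 2) ^ k * (1 / 2) := by gcongr
      _ = _ := by ring

theorem abs_tsum_mul_pow_sub_sum_le {a : ℕ → ℝ} (ha : ∀ k, |a k| ≤ 1 / (k.factorial : ℝ) ^ 2)
    {x : ℝ} {N : ℕ} (hN : 2 * |x| ≤ ((N : ℝ) + 1) ^ 2) :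
    |∑' k, a k * x ^ k - ∑ k ∈ range N, a k * x ^ k| ≤
      2 * (|x| ^ N / (N.factorial : ℝ) ^ 2) := by
  rw [← (summable_mul_pow_of_abs_le ha x).sum_add_tsum_nat_add N, add_sub_cancel_left,
    ← Real.norm_eq_abs, mul_comm]
  refine tsum_of_norm_bounded (hasSum_geometric_two.mul_left _) fun k => ?_
  refine le_trans ?_ (pow_div_factorial_sq_le (abs_nonneg x) hN k)
  rw [Real.norm_eq_abs, abs_mul, abs_pow, div_eq_inv_mul, ← one_div]
  gcongr
  exact ha _

/-- The coefficients of `S̃₆[eˣ]`. -/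
noncomputable def expCoeff (k : ℕ) : ℝ :=
  ((1 : ℝ) / k.factorial) * ((1 : ℝ) / (k + 1).factorial) -
    (if k < 6 then 0 else (1 : ℝ) / (k - 6).factorial) * ((1 : ℝ) / (k + 7).factorial)

theorem factorial_mul_factorial_le (m : ℕ) :
    (m + 6).factorial * (m + 7).factorial ≤ m.factorial * (m + 13).factorial := by
  have h₁ : (m + 6).factorial ≤ m.factorial * (m + 6) ^ 6 := by
    simpa [Nat.factorial_mul_ascFactorial] using
      Nat.mul_le_mul_left m.factorial (Nat.ascFactorial_le_pow_add m 6)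
  have h₂ : (m + 7).factorial * (m + 8) ^ 6 ≤ (m + 13).factorial :=
    Nat.factorial_mul_pow_le_factorial (m := m + 7) (n := 6)
  calc (m + 6).factorial * (m + 7).factorial
      ≤ m.factorial * (m + 8) ^ 6 * (m + 7).factorial := by
        gcongr
        exact h₁.trans (by gcongr; norm_num)
    _ = m.factorial * ((m + 7).factorial * (m + 8) ^ 6) := by ring
    _ ≤ _ := by gcongr

theorem abs_expCoeff_le (k : ℕ) : |expCoeff k| ≤ 1 / (k.factorial : ℝ) ^ 2 := by
  have hk : ((1 : ℝ) / k.factorial) * ((1 : ℝ) / (k + 1).factorial) ≤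
      1 / (k.factorial : ℝ) ^ 2 := by
    rw [one_div_mul_one_div, sq]
    gcongr
    exact Nat.le_succ k
  have hsub : 0 ≤ expCoeff k := by
    unfold expCoeff
    split_ifs with h
    · rw [zero_mul, sub_zero]; positivity
    · obtain ⟨m, rfl⟩ := Nat.exists_eq_add_of_le' (not_lt.1 h)
      rw [sub_nonneg, one_div_mul_one_div, one_div_mul_one_div, Nat.add_sub_cancel]
      refine one_div_le_one_div_of_le (by positivity) ?_
      exact_mod_cast factorial_mul_factorial_le m
  rw [abs_of_nonneg hsub]
  refine le_trans (sub_le_self _ ?_) hk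
  split_ifs <;> positivity

theorem sum_expCoeff_le : ∑ k ∈ range 24, expCoeff k * (-56) ^ k ≤ -0.00974 := by
  norm_num [sum_range_succ, expCoeff, Nat.factorial]

theorem abs_sum_derivCoeff_expCoeff_le :
    |∑ k ∈ range 24, derivCoeff expCoeff k * (-56) ^ k| ≤ 0.00025 := by
  norm_num [sum_range_succ, derivCoeff, expCoeff, Nat.factorial]

theorem sum_derivCoeff_derivCoeff_expCoeff_le :
    ∑ k ∈ range 24, derivCoeff (derivCoeff expCoeff) k * (-56) ^ k ≤ -0.000316 := by
  norm_num [sum_range_succ, derivCoeff, expCoeff, Nat.factorial]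

/-- The Laguerre expression of `g = S̃₆[eˣ]` is negative at `x₀ = -56`:
`(g'(x₀))² - g(x₀) g''(x₀) < 0`, where `g(x) = ∑ₖ (aₖ aₖ₊₁ - aₖ₋₆ aₖ₊₇) xᵏ`, `aⱼ = 1/j!`
for `j ≥ 0` and `aⱼ = 0` for `j < 0`.  Hence `g ∉ 𝓛-𝓟`. -/
theorem S6tilde_exp_laguerre_negative :
    let c : ℕ → ℝ := fun k =>
      ((1 : ℝ) / k.factorial) * ((1 : ℝ) / (k + 1).factorial) -
        (if k < 6 then 0 else (1 : ℝ) / (k - 6).factorial) * ((1 : ℝ) / (k + 7).factorial)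
    let g : ℝ → ℝ := fun x => ∑' k : ℕ, c k * x ^ k
    (deriv g (-56)) ^ 2 - g (-56) * deriv (deriv g) (-56) < 0 := by
  intro c g
  have h0 := abs_expCoeff_le
  have h1 := abs_derivCoeff_le h0
  have h2 := abs_derivCoeff_le h1
  have hg' : deriv g = fun x => ∑' k, derivCoeff expCoeff k * x ^ k :=
    funext fun x => (hasDerivAt_tsum_mul_pow h0 x).deriv
  have hg'' : deriv (deriv g) (-56) =
      ∑' k, derivCoeff (derivCoeff expCoeff) k * (-56) ^ k := by
    rw [hg']
    exact (hasDerivAt_tsum_mul_pow h1 _).deriv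
  have hN : 2 * |(-56 : ℝ)| ≤ (((24 : ℕ) : ℝ) + 1) ^ 2 := by norm_num
  have e0 := abs_tsum_mul_pow_sub_sum_le h0 hN
  have e1 := abs_tsum_mul_pow_sub_sum_le h1 hN
  have e2 := abs_tsum_mul_pow_sub_sum_le h2 hN
  have herr : 2 * (|(-56 : ℝ)| ^ 24 / ((24 : ℕ).factorial : ℝ) ^ 2) ≤ 0.00001 := by
    norm_num [Nat.factorial]
  have t0 : g (-56) ≤ -0.0097 := by
    have : g (-56) = ∑' k, expCoeff k * (-56) ^ k := rfl
    rw [this]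
    have s0 := sum_expCoeff_le
    linarith [(abs_le.1 (e0.trans herr)).2]
  have t1 : |deriv g (-56)| ≤ 0.0003 := by
    rw [hg']
    have s1 := abs_sum_derivCoeff_expCoeff_le
    rw [abs_le] at s1 ⊢
    have e := abs_le.1 (e1.trans herr)
    constructor <;> linarith [e.1, e.2, s1.1, s1.2]
  have t2 : deriv (deriv g) (-56) ≤ -0.0003 := by
    rw [hg'']
    have s2 := sum_derivCoeff_derivCoeff_expCoeff_le
    linarith [(abs_le.1 (e2.trans herr)).2]
  have hsq : deriv g (-56) ^ 2 ≤ 0.0003 ^ 2 := by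
    rw [← sq_abs]
    gcongr
  norm_num1 at t0 t2 hsq
  nlinarith [mul_nonneg (sub_nonneg.2 t0) (sub_nonneg.2 t2)]
end

section
/- There exists a real polynomial p(x) = sum_{k=0}^n a_k x^k with nonnegative coefficients and only real zeros such that the polynomial S~_6[p](x) = sum_{k=0}^n (a_k a_{k+1} - a_{k-6} a_{k+7}) x^k (with a_j = 0 for j < 0 or j > n) is nonzero and fails to have nonnegative coefficients with only real zeros. -/
open Polynomial Finset

/-- The Laguerre inequality for a nonzero real polynomial with only real zeros. -/
theorem laguerre_inequality (q : ℝ[X]) (hq : q ≠ 0)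
    (hroots : ∀ z : ℂ, aeval z q = 0 → ∃ x : ℝ, (x : ℂ) = z) (x : ℝ) :
    0 ≤ (derivative q).eval x ^ 2 - q.eval x * (derivative (derivative q)).eval x := by
  induction hn : q.natDegree generalizing q with
  | zero =>
    rw [eq_C_of_natDegree_eq_zero hn]
    simp
  | succ n ih =>
    obtain ⟨z, hz⟩ := IsAlgClosed.exists_aeval_eq_zero ℂ q
      (fun h => by rw [degree_eq_natDegree hq, hn] at h; exact absurd h (by norm_cast))
    obtain ⟨r, rfl⟩ := hroots z hz
    have hr : q.IsRoot r := by
      have h : aeval ((algebraMap ℝ ℂ) r) q = 0 := hz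
      rw [aeval_algebraMap_apply] at h
      simpa using h
    obtain ⟨g, rfl⟩ := dvd_iff_isRoot.mpr hr
    have hg : g ≠ 0 := right_ne_zero_of_mul hq
    have key := ih g hg (fun z hz => hroots z (by simp [hz])) (by
      rw [natDegree_mul (X_sub_C_ne_zero r) hg, natDegree_X_sub_C] at hn
      omega)
    simp only [derivative_mul, derivative_sub, derivative_X, derivative_C, derivative_add,
      eval_add, eval_mul, eval_sub, eval_X, eval_C, sub_zero, one_mul]
    nlinarith [mul_nonneg (sq_nonneg (x - r)) key, sq_nonneg (g.eval x)]

/-- The binomial coefficient, in a form that the kernel evaluates quickly. -/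
def binom (n k : ℕ) : ℕ := n.descFactorial k / k.factorial

theorem binom_eq_choose (n k : ℕ) : binom n k = n.choose k :=
  (Nat.choose_eq_descFactorial_div_factorial n k).symm

/-- The leading term `aₖ aₖ₊₁` of the `k`-th coefficient of `S̃₆[(X + 1) ^ 285]`. -/
def plusCoeff (k : ℕ) : ℕ := binom 285 k * binom 285 (k + 1)

/-- The subtrahend `aₖ₋₆ aₖ₊₇` of the `k`-th coefficient of `S̃₆[(X + 1) ^ 285]`. -/
def minusCoeff (k : ℕ) : ℕ :=
  (if k < 6 then 0 else binom 285 (k - 6)) * binom 285 (k + 7)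

/-- The sum of `w k * z ^ k * (if k is even then a k else b k)` over `k < 2 * m`. -/
def pairSum (w a b : ℕ → ℕ) (z : ℕ) : ℕ → ℕ
  | 0 => 0
  | m + 1 => pairSum w a b z m +
      (w (2 * m) * a (2 * m) * z ^ (2 * m) + w (2 * m + 1) * b (2 * m + 1) * z ^ (2 * m + 1))

theorem sum_mul_neg_pow_eq_pairSum_sub (w a b : ℕ → ℕ) (z m : ℕ) :
    ∑ k ∈ range (2 * m), (w k : ℝ) * ((a k : ℝ) - b k) * (-(z : ℝ)) ^ k =
      pairSum w a b z m - pairSum w b a z m := by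
  induction m with
  | zero => simp [pairSum]
  | succ m ih =>
    rw [show 2 * (m + 1) = 2 * m + 1 + 1 by ring, sum_range_succ, sum_range_succ, ih,
      (even_two_mul m).neg_pow, (odd_two_mul_add_one m).neg_pow]
    simp only [pairSum]
    push_cast
    ring

/-- The positive part of the `w`-weighted sum of `S̃₆[(X + 1) ^ 285]` at `-1480`. -/
def weightedPlus (w : ℕ → ℕ) : ℕ := pairSum w plusCoeff minusCoeff 1480 143

/-- The negative part of the `w`-weighted sum of `S̃₆[(X + 1) ^ 285]` at `-1480`. -/
def weightedMinus (w : ℕ → ℕ) : ℕ := pairSum w minusCoeff plusCoeff 1480 143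

theorem weightedPlus_weightedMinus_lt :
    weightedPlus (fun k => k) ^ 2 + weightedMinus (fun k => k) ^ 2 +
        weightedPlus (fun _ => 1) * weightedMinus (fun k => k * (k - 1)) +
        weightedMinus (fun _ => 1) * weightedPlus (fun k => k * (k - 1)) <
      2 * weightedPlus (fun k => k) * weightedMinus (fun k => k) +
        weightedPlus (fun _ => 1) * weightedPlus (fun k => k * (k - 1)) +
        weightedMinus (fun _ => 1) * weightedMinus (fun k => k * (k - 1)) := by
  decide +kernel

theorem mul_eval_derivative_sum (c : ℕ → ℝ) (n : ℕ) (x : ℝ) :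
    x * (derivative (∑ k ∈ range n, C (c k) * X ^ k)).eval x =
      ∑ k ∈ range n, (k : ℝ) * c k * x ^ k := by
  simp only [derivative_sum, derivative_C_mul_X_pow, eval_finsetSum, eval_mul, eval_C, eval_pow,
    eval_X, mul_sum]
  refine sum_congr rfl fun k _ => ?_
  rcases k with _ | k
  · simp
  · rw [Nat.add_sub_cancel]
    ring

theorem sq_mul_eval_derivative_derivative_sum (c : ℕ → ℝ) (n : ℕ) (x : ℝ) :
    x ^ 2 * (derivative (derivative (∑ k ∈ range n, C (c k) * X ^ k))).eval x =
      ∑ k ∈ range n, ((k * (k - 1) : ℕ) : ℝ) * c k * x ^ k := by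
  simp only [derivative_sum, derivative_C_mul_X_pow, eval_finsetSum, eval_mul, eval_C, eval_pow,
    eval_X, mul_sum]
  refine sum_congr rfl fun k _ => ?_
  rcases k with _ | _ | k
  · simp
  · simp
  · simp only [Nat.add_sub_cancel]
    push_cast
    ring

theorem laguerre_neg_of_coeff (c : ℕ → ℝ) (hc : ∀ k, c k = (plusCoeff k : ℝ) - minusCoeff k) :
    let q := ∑ k ∈ range 286, C (c k) * X ^ k
    (derivative q).eval (-1480) ^ 2 -
      q.eval (-1480) * (derivative (derivative q)).eval (-1480) < 0 := by
  intro q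
  have h (w : ℕ → ℕ) : ∑ k ∈ range 286, (w k : ℝ) * c k * (-1480) ^ k =
      weightedPlus w - weightedMinus w := by
    have hsum := sum_mul_neg_pow_eq_pairSum_sub w plusCoeff minusCoeff 1480 143
    simp only [← hc, Nat.cast_ofNat] at hsum
    exact hsum
  have h0 : q.eval (-1480) = weightedPlus (fun _ => 1) - weightedMinus (fun _ => 1) := by
    rw [← h]
    simp [q, eval_finsetSum]
  have h1 : -1480 * (derivative q).eval (-1480) =
      weightedPlus (fun k => k) - weightedMinus (fun k => k) := by
    rw [← h]
    exact mul_eval_derivative_sum c 286 (-1480)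
  have h2 : (-1480) ^ 2 * (derivative (derivative q)).eval (-1480) =
      weightedPlus (fun k => k * (k - 1)) - weightedMinus (fun k => k * (k - 1)) := by
    rw [← h]
    exact sq_mul_eval_derivative_derivative_sum c 286 (-1480)
  have hlt := (Nat.cast_lt (α := ℝ)).mpr weightedPlus_weightedMinus_lt
  simp only [Nat.cast_add, Nat.cast_mul, Nat.cast_pow, Nat.cast_ofNat] at hlt
  have key : (-1480 * (derivative q).eval (-1480)) ^ 2 -
      q.eval (-1480) * ((-1480) ^ 2 * (derivative (derivative q)).eval (-1480)) < 0 := by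
    rw [h0, h1, h2]
    linarith
  linarith

/-- There is a real polynomial `p` with nonnegative coefficients and only real zeros such
that `S̃₆[p](x) = ∑ₖ (aₖ aₖ₊₁ - aₖ₋₆ aₖ₊₇) xᵏ` (out-of-range coefficients taken to be `0`)
is nonzero and fails to have nonnegative coefficients with only real zeros. -/
theorem S6tilde_counterexample :
    ∃ p : Polynomial ℝ,
      (∀ k, 0 ≤ p.coeff k) ∧
      (∀ z : ℂ, aeval z p = 0 → ∃ x : ℝ, (x : ℂ) = z) ∧
      (let q := ∑ k ∈ range (p.natDegree + 1),
        C (p.coeff k * p.coeff (k + 1) - (if k < 6 then 0 else p.coeff (k - 6)) * p.coeff (k + 7))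
          * X ^ k
       q ≠ 0 ∧
        ¬((∀ k, 0 ≤ q.coeff k) ∧ ∀ z : ℂ, aeval z q = 0 → ∃ x : ℝ, (x : ℂ) = z)) := by
  have hcoeff (k : ℕ) : ((X + 1 : ℝ[X]) ^ 285).coeff k = (binom 285 k : ℝ) := by
    rw [coeff_X_add_one_pow, binom_eq_choose]
  have hdeg : ((X + 1 : ℝ[X]) ^ 285).natDegree = 285 := by
    rw [natDegree_pow, ← C_1, natDegree_X_add_C]
  refine ⟨(X + 1) ^ 285, fun k => ?_, fun z hz => ⟨-1, ?_⟩, ?_⟩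
  · rw [hcoeff]
    exact Nat.cast_nonneg _
  · rw [map_pow] at hz
    have hz1 : z + 1 = 0 := by simpa using eq_zero_of_pow_eq_zero hz
    push_cast
    linear_combination -hz1
  · intro q
    set c : ℕ → ℝ := fun k => (binom 285 k : ℝ) * binom 285 (k + 1) -
      (if k < 6 then 0 else (binom 285 (k - 6) : ℝ)) * binom 285 (k + 7) with hc
    have hqc : q = ∑ k ∈ range 286, C (c k) * X ^ k := by
      simp only [q, hdeg, hcoeff, hc]
    have hneg := laguerre_neg_of_coeff c (fun k => by simp [hc, plusCoeff, minusCoeff])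
    simp only [← hqc] at hneg
    have hq : q ≠ 0 := by
      intro h0
      simp [h0] at hneg
    exact ⟨hq, fun h => absurd (laguerre_inequality q hq h.2 (-1480)) (not_le.mpr hneg)⟩
end

section
/- For natural numbers d >= 1 and n, the real polynomial F_d[(1+x)^n](x) = sum_{k=0}^n D_k^{(d)} x^k has only real negative zeros, where D_k^{(d)} = det( (a_{k-i+j})_{0<=i,j<=d-1} ) with a_m = binom(n,m) for 0 <= m <= n and a_m = 0 otherwise; equivalently, the polynomial sum_{k=0}^n [ prod_{j=0}^{d-1} binom(n+j, k+j) / binom(n-k+j, n-k) ] x^k has only real negative zeros. -/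
open Polynomial Finset

/-- All complex zeros of `p` are real. Since every number is a zero of `0`, this forces `p ≠ 0`. -/
def RealRooted (p : ℂ[X]) : Prop := ∀ z : ℂ, p.IsRoot z → z.im = 0

theorem RealRooted.ne_zero {p : ℂ[X]} (hp : RealRooted p) : p ≠ 0 := by
  rintro rfl
  simpa using hp Complex.I (by simp)

theorem RealRooted.of_mul_left {p q : ℂ[X]} (h : RealRooted (p * q)) : RealRooted q :=
  fun z hz => h z (by simp_all [IsRoot])

theorem RealRooted.X_pow (m : ℕ) : RealRooted (X ^ m) := fun z hz => by
  have h : z = 0 := by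
    rw [IsRoot, eval_pow, eval_X] at hz
    exact eq_zero_of_pow_eq_zero hz
  simp [h]

/-- The Hermite–Poulain step: `D - w` preserves real-rootedness for real `w ≠ 0`. -/
theorem RealRooted.derivative_sub_C_mul {p : ℂ[X]} (hp : RealRooted p) {w : ℂ} (hw : w.im = 0)
    (hw0 : w ≠ 0) : RealRooted (derivative p - C w * p) := by
  intro z hz
  by_contra him
  have hpz : p.eval z ≠ 0 := fun h => him (hp z h)
  have hdiv : p.derivative.eval z / p.eval z = w := by
    rw [div_eq_iff hpz]
    simpa [IsRoot, sub_eq_zero] using hz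
  rw [(IsAlgClosed.splits p).eval_derivative_div_eval_of_ne_zero hpz] at hdiv
  have hsum : (p.roots.map fun r => z.im * (1 / (z - r)).im).sum = 0 := by
    have h := congrArg (fun t : ℂ => z.im * t.im) hdiv
    simp only [hw, mul_zero] at h
    rw [Multiset.sum_map_mul_left, ← h]
    congr 1
    have := map_multiset_sum Complex.imAddGroupHom (p.roots.map fun r => 1 / (z - r))
    rw [Multiset.map_map] at this
    exact this.symm
  have hroots : p.roots ≠ 0 := by
    intro h
    rw [h] at hdiv
    exact hw0 (by simpa using hdiv.symm)
  have hlt : (p.roots.map fun r => z.im * (1 / (z - r)).im).sum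
      < (p.roots.map fun _ => (0 : ℝ)).sum := by
    refine Multiset.sum_lt_sum_of_nonempty hroots fun r hr => ?_
    have hr0 : r.im = 0 := hp r (mem_roots'.1 hr).2
    have hne : z - r ≠ 0 := fun h => him (by rw [sub_eq_zero.1 h, hr0])
    have hpos : 0 < Complex.normSq (z - r) := Complex.normSq_pos.2 hne
    rw [one_div, Complex.inv_im, Complex.sub_im, hr0, sub_zero, neg_div, mul_neg, neg_lt_zero,
      ← mul_div_assoc]
    exact div_pos (mul_self_pos.2 him) hpos
  rw [hsum] at hlt
  simp at hlt

/-- Hermite–Poulain theorem: `f(D) p` is real-rooted when `f` and `p` are and `f(0) ≠ 0`. -/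
theorem RealRooted.aeval_derivative {f p : ℂ[X]} (hf : RealRooted f) (hf0 : f.eval 0 ≠ 0)
    (hp : RealRooted p) :
    RealRooted (aeval (derivative : Module.End ℂ ℂ[X]) f p) := by
  have key : ∀ s : Multiset ℂ, (∀ r ∈ s, r.im = 0 ∧ r ≠ 0) →
      RealRooted (aeval (derivative : Module.End ℂ ℂ[X])
        (s.map fun r => X - C r).prod p) := by
    intro s
    induction s using Multiset.induction_on with
    | empty => intro _; simpa using hp
    | cons r s ih =>
      intro h
      have h1 := ih fun t ht => h t (Multiset.mem_cons_of_mem ht)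
      have h2 := h r (Multiset.mem_cons_self r s)
      have h3 := h1.derivative_sub_C_mul h2.1 h2.2
      rw [Multiset.map_cons, Multiset.prod_cons, map_mul, Module.End.mul_apply, map_sub,
        aeval_X, aeval_C, LinearMap.sub_apply, Module.algebraMap_end_apply, smul_eq_C_mul]
      exact h3
  have h := key f.roots fun r hr => ⟨hf r (mem_roots'.1 hr).2, by
    rintro rfl
    exact hf0 (mem_roots'.1 hr).2⟩
  rw [(IsAlgClosed.splits f).eq_prod_roots, map_mul, aeval_C, Module.End.mul_apply,
    Module.algebraMap_end_apply]
  intro z hz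
  rw [IsRoot, eval_smul, smul_eq_mul, mul_eq_zero] at hz
  exact h z (hz.resolve_left (leadingCoeff_ne_zero.2 hf.ne_zero))

/-- Dividing by `(n + m - k)!` and reversing the coefficients preserves real-rootedness. -/
theorem RealRooted.sum_div_factorial {n : ℕ} {c : ℕ → ℂ} (hc : c 0 ≠ 0)
    (h : RealRooted (∑ k ∈ range (n + 1), C (c k) * X ^ k)) (m : ℕ) :
    RealRooted (∑ k ∈ range (n + 1), C (c (n - k) / ((k + m).factorial : ℂ)) * X ^ k) := by
  have h0 : (∑ k ∈ range (n + 1), C (c k) * X ^ k).eval 0 ≠ 0 := by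
    rw [eval_finsetSum, sum_range_succ']
    simpa using hc
  have h1 := h.aeval_derivative h0 (RealRooted.X_pow (n + m))
  refine RealRooted.of_mul_left (p := C ((n + m).factorial : ℂ) * X ^ m) ?_
  convert h1 using 1
  rw [map_sum, LinearMap.sum_apply, ← sum_range_reflect, mul_sum]
  refine sum_congr rfl fun k hk => ?_
  have hk' : k ≤ n := Nat.lt_succ_iff.1 (mem_range.1 hk)
  rw [map_mul, aeval_C, map_pow (aeval _), aeval_X, Module.End.mul_apply, Module.algebraMap_end_apply,
    Module.End.pow_apply, iterate_derivative_X_pow_eq_C_mul, smul_eq_C_mul,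
    show n + 1 - 1 - k = n - k by omega, Nat.sub_sub_self hk',
    show n + m - k = m + (n - k) by omega, pow_add]
  have hfac : (c k * ((n + m).descFactorial k : ℂ))
      = (n + m).factorial * (c k / ((n - k + m).factorial : ℂ)) := by
    have h2 := Nat.factorial_mul_descFactorial (show k ≤ n + m by omega)
    rw [show n + m - k = n - k + m by omega] at h2
    rw [← h2]
    have : ((n - k + m).factorial : ℂ) ≠ 0 := Nat.cast_ne_zero.2 (Nat.factorial_ne_zero _)
    push_cast
    field_simp
  rw [← mul_assoc (C (c k)), ← C_mul, hfac, C_mul]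
  ring

/-- The weights `∏_{j<d} 1 / ((k+j)! (n-k+j)!)`, which are proportional to the number of plane
partitions in a `d × k × (n-k)` box. -/
noncomputable def boxWeight (d n k : ℕ) : ℝ :=
  ∏ j ∈ range d, (1 / (((k + j).factorial : ℝ) * ((n - k + j).factorial : ℝ)))

theorem boxWeight_pos (d n k : ℕ) : 0 < boxWeight d n k :=
  prod_pos fun _ _ => by positivity

theorem realRooted_boxWeight (d n : ℕ) :
    RealRooted (∑ k ∈ range (n + 1), C (boxWeight (d + 1) n k : ℂ) * X ^ k) := by
  induction d with
  | zero =>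
    have h : RealRooted ((X + 1 : ℂ[X]) ^ n) := fun z hz => by
      have : z + 1 = 0 := by
        rw [IsRoot] at hz
        simp only [eval_pow, eval_add, eval_X, eval_one] at hz
        exact eq_zero_of_pow_eq_zero hz
      rw [eq_neg_of_add_eq_zero_left this]
      simp
    refine RealRooted.of_mul_left (p := C (n.factorial : ℂ)) ?_
    convert h using 1
    rw [add_pow, mul_sum]
    refine sum_congr rfl fun k hk => ?_
    have hk' : k ≤ n := Nat.lt_succ_iff.1 (mem_range.1 hk)
    rw [one_pow, mul_one, ← mul_assoc, ← C_mul, mul_comm, ← C_eq_natCast]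
    congr 2
    rw [Nat.cast_choose ℂ hk', boxWeight]
    simp [div_eq_mul_inv]
  | succ d ih =>
    have hne : ∀ k, (boxWeight (d + 1) n k : ℂ) ≠ 0 := fun k =>
      Complex.ofReal_ne_zero.2 (boxWeight_pos _ _ _).ne'
    have h1 := ih.sum_div_factorial (hne 0) (d + 1)
    have h2 := h1.sum_div_factorial
      (div_ne_zero (hne _) (Nat.cast_ne_zero.2 (Nat.factorial_ne_zero _))) (d + 1)
    convert h2 using 1
    refine sum_congr rfl fun k hk => ?_
    have hk' : k ≤ n := Nat.lt_succ_iff.1 (mem_range.1 hk)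
    rw [Nat.sub_sub_self hk', boxWeight, prod_range_succ, ← boxWeight]
    congr 2
    push_cast
    rw [div_div, mul_one_div, mul_comm ((k + (d + 1)).factorial : ℂ)]

/-- The binomial coefficient `binom(n, z)` for an integer `z`, zero when `z < 0`. -/
noncomputable def intChoose (n : ℕ) (z : ℤ) : ℝ :=
  if 0 ≤ z then (n.choose z.toNat : ℝ) else 0

theorem intChoose_natCast (n m : ℕ) : intChoose n m = n.choose m := by
  simp [intChoose]

theorem intChoose_of_neg {n : ℕ} {z : ℤ} (hz : z < 0) : intChoose n z = 0 := by
  simp [intChoose, hz]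

theorem intChoose_add_intChoose (n : ℕ) (z : ℤ) :
    intChoose n z + intChoose n (z + 1) = intChoose (n + 1) (z + 1) := by
  rcases lt_or_ge z 0 with hz | hz
  · rcases eq_or_lt_of_le (Int.add_one_le_iff.2 hz) with h | h
    · rw [h, intChoose_of_neg hz]
      simp [intChoose]
    · rw [intChoose_of_neg hz, intChoose_of_neg h, intChoose_of_neg h, add_zero]
  · lift z to ℕ using hz
    rw [← Nat.cast_succ, intChoose_natCast, intChoose_natCast, intChoose_natCast,
      Nat.choose_succ_succ]
    push_cast
    rfl

theorem sum_choose_mul_intChoose (j n : ℕ) (z : ℤ) :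
    ∑ l ∈ range (j + 1), (j.choose l : ℝ) * intChoose n (z + l) = intChoose (n + j) (z + j) := by
  induction j generalizing n z with
  | zero => simp
  | succ j ih =>
    rw [Finset.sum_choose_succ_mul (fun l _ => intChoose n (z + l)), add_comm, ← sum_add_distrib]
    have h := ih (n + 1) (z + 1)
    rw [show n + (j + 1) = n + 1 + j by ring, show z + ((j + 1 : ℕ) : ℤ) = z + 1 + j by
      push_cast; ring, ← h]
    refine sum_congr rfl fun l _ => ?_
    rw [← mul_add, show z + 1 + (l : ℤ) = z + l + 1 by ring, ← intChoose_add_intChoose,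
      show z + ((l + 1 : ℕ) : ℤ) = z + l + 1 by push_cast; ring, add_comm]

theorem intChoose_eq_descFactorial {n k : ℕ} (hk : k ≤ n) (i j : ℕ) :
    intChoose (n + j) ((k : ℤ) - i + j)
      = ((n + j).factorial : ℝ) / ((k + j).factorial : ℝ)
        * ((1 / ((n - k + i).factorial : ℝ)) * ((k + j).descFactorial i : ℝ)) := by
  rcases lt_or_ge (k + j) i with h | h
  · rw [intChoose_of_neg (by omega), Nat.descFactorial_of_lt h]
    simp
  · rw [show (k : ℤ) - i + j = ((k + j - i : ℕ) : ℤ) by omega, intChoose_natCast,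
      Nat.cast_choose ℝ (by omega), ← Nat.factorial_mul_descFactorial h,
      show n + j - (k + j - i) = n - k + i by omega]
    have h1 : ((k + j).descFactorial i : ℝ) ≠ 0 :=
      Nat.cast_ne_zero.2 (Nat.descFactorial_eq_zero_iff_lt.not.2 h.not_gt)
    push_cast
    field_simp

/-- MacMahon's box formula for `det (binom(n, k-i+j))`, up to a constant independent of `k`. -/
theorem det_intChoose {n k : ℕ} (d : ℕ) (hk : k ≤ n) :
    Matrix.det (Matrix.of fun i j : Fin d => intChoose n ((k : ℤ) - i + j))
      = (∏ j : Fin d, ((n + j).factorial : ℝ))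
        * (Matrix.vandermonde fun j : Fin d => (j : ℝ)).det * boxWeight d n k := by
  have hU : (Matrix.of fun l j : Fin d => ((j : ℕ).choose l : ℝ)).det = 1 := by
    rw [Matrix.det_of_isUpperTriangular]
    · simp
    · intro i j hij
      simpa using Nat.choose_eq_zero_of_lt hij
  have hmul : (Matrix.of fun i j : Fin d => intChoose n ((k : ℤ) - i + j))
        * (Matrix.of fun l j : Fin d => ((j : ℕ).choose l : ℝ))
      = Matrix.of fun i j : Fin d => ((n + j).factorial : ℝ) / ((k + j).factorial : ℝ) *
          (Matrix.of fun i j : Fin d => (1 / ((n - k + i).factorial : ℝ)) *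
            (Matrix.of fun i j : Fin d => ((k + j).descFactorial i : ℝ)) i j) i j := by
    ext i j
    simp only [Matrix.mul_apply, Matrix.of_apply]
    rw [← intChoose_eq_descFactorial hk, ← sum_choose_mul_intChoose,
      Fin.sum_univ_eq_sum_range
        (fun l => intChoose n ((k : ℤ) - i + l) * ((j : ℕ).choose l : ℝ)) d]
    symm
    simp_rw [mul_comm (intChoose _ _)]
    refine sum_subset (range_subset_range.2 j.2) fun l _ hl => ?_
    rw [Nat.choose_eq_zero_of_lt (by simpa [Nat.lt_succ_iff] using hl)]
    simp
  have hV : (Matrix.of fun i j : Fin d => ((k + j).descFactorial i : ℝ)).det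
      = (Matrix.vandermonde fun j : Fin d => (j : ℝ)).det := by
    rw [← Matrix.det_vandermonde_add _ (k : ℝ),
      Matrix.det_eval_matrixOfPolynomials_eq_det_vandermonde _
        (fun i : Fin d => descPochhammer ℝ i) (fun i => descPochhammer_natDegree ℝ i)
        (fun i => monic_descPochhammer ℝ i), ← Matrix.det_transpose]
    congr 1
    ext i j
    simp only [Matrix.transpose_apply, Matrix.of_apply]
    rw [← descPochhammer_eval_eq_descFactorial]
    push_cast
    rw [add_comm]
  rw [← mul_one (Matrix.det _), ← hU, ← Matrix.det_mul, hmul, Matrix.det_mul_row,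
    Matrix.det_mul_column, hV, boxWeight,
    ← Fin.prod_univ_eq_prod_range
      (fun j => 1 / (((k + j).factorial : ℝ) * ((n - k + j).factorial : ℝ))) d]
  simp only [div_eq_mul_inv, one_mul, mul_inv, prod_mul_distrib]
  ring

theorem det_vandermonde_natCast_pos (d : ℕ) :
    0 < (Matrix.vandermonde fun j : Fin d => (j : ℝ)).det := by
  rw [Matrix.det_vandermonde]
  refine prod_pos fun i _ => prod_pos fun j hj => ?_
  rw [sub_pos, Nat.cast_lt]
  exact Fin.lt_def.1 (mem_Ioi.1 hj)

/-- For `d ≥ 1` and `n : ℕ`, the polynomial `F_d[(1+x)ⁿ](x) = ∑_{k=0}^n D_k^{(d)} xᵏ` has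
only real negative zeros, where `D_k^{(d)} = det(a_{k-i+j})_{0 ≤ i,j ≤ d-1}` with
`aₘ = binom(n,m)` for `0 ≤ m ≤ n` and `aₘ = 0` otherwise. -/
theorem Fd_binomial_real_negative_zeros (d n : ℕ) (hd : 1 ≤ d) :
    ∀ z : ℂ,
      aeval z (∑ k ∈ range (n + 1),
          C (Matrix.det (Matrix.of fun i j : Fin d =>
              if 0 ≤ (k : ℤ) - i + j then (n.choose ((k : ℤ) - i + j).toNat : ℝ) else 0))
            * X ^ k) = 0 →
      ∃ x : ℝ, x < 0 ∧ (x : ℂ) = z := by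
  intro z hz
  obtain ⟨A, hA, hdet⟩ : ∃ A : ℝ, A ≠ 0 ∧ ∀ k ∈ range (n + 1),
      Matrix.det (Matrix.of fun i j : Fin d =>
        if 0 ≤ (k : ℤ) - i + j then (n.choose ((k : ℤ) - i + j).toNat : ℝ) else 0)
        = A * boxWeight d n k :=
    ⟨_, (mul_pos (prod_pos fun _ _ => Nat.cast_pos.2 (Nat.factorial_pos _))
      (det_vandermonde_natCast_pos d)).ne',
      fun k hk => det_intChoose d (Nat.lt_succ_iff.1 (mem_range.1 hk))⟩
  have hsum : ∑ k ∈ range (n + 1), (boxWeight d n k : ℂ) * z ^ k = 0 := by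
    rw [sum_congr rfl fun k hk => by rw [hdet k hk]] at hz
    simp only [map_sum, map_mul, aeval_C, map_pow, aeval_X, Complex.coe_algebraMap, mul_assoc,
      ← mul_sum, mul_eq_zero, Complex.ofReal_eq_zero, hA, false_or] at hz
    exact hz
  obtain ⟨d, rfl⟩ := Nat.exists_eq_add_of_le' hd
  have him : z.im = 0 := realRooted_boxWeight d n z (by
    simpa [IsRoot, eval_finsetSum] using hsum)
  obtain ⟨x, rfl⟩ : ∃ x : ℝ, (x : ℂ) = z := ⟨z.re, Complex.ext rfl (by simp [him])⟩
  refine ⟨x, ?_, rfl⟩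
  by_contra! hx
  have hpos : 0 < ∑ k ∈ range (n + 1), boxWeight (d + 1) n k * x ^ k := by
    rw [sum_range_succ']
    refine add_pos_of_nonneg_of_pos
      (sum_nonneg fun k _ => mul_nonneg (boxWeight_pos _ _ _).le (pow_nonneg hx _)) ?_
    simpa using boxWeight_pos _ _ _
  exact hpos.ne' (by exact_mod_cast hsum)
end
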